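/- Let a, b, c be reals with a > b > 0 and c > 0, and let f : ℝ → ℝ be a nonnegative measurable function. Then ∫₀^∞ ∫₀^∞ x^(-1/2)·y^(-1)·(x+y)^(-1) · f(xy/(x+y)) · exp(-a/x - b/y - c·xy/(x+y)) dx dy = (a-b)^(-1/2) · √π · ∫₀^∞ f(t) · t^(-1) · exp(-c·t) · exp(-b/t) · erf(√((a-b)/t)) dt. -/

import Mathlib

open MeasureTheory Real

/-- The error function `erf x = (2/√π) ∫₀ˣ exp (-u²) du`. -/
noncomputable def erf (x : ℝ) : ℝ :=
  (2 / Real.sqrt Real.pi) * ∫ u in (0:ℝ)..x, Real.exp (-u ^ 2)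

lemma inner_subst (a b c x : ℝ) (hx : 0 < x) (f : ℝ → ℝ) (hf0 : ∀ t, 0 ≤ f t) :
    (∫⁻ y in Set.Ioi (0:ℝ),
        ENNReal.ofReal (x ^ (-(1:ℝ)/2) * y⁻¹ * (x + y)⁻¹ *
          f (x * y / (x + y)) *
          Real.exp (-a / x - b / y - c * (x * y / (x + y)))))
    = ∫⁻ t in Set.Ioo 0 x, ENNReal.ofReal (f t * t⁻¹ * Real.exp (-c * t) * Real.exp (-b / t)) *
        ENNReal.ofReal (x ^ (-(1:ℝ)/2) * x⁻¹ * Real.exp (-(a - b) / x)) := by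
  have himg : (fun y : ℝ => x * y / (x + y)) '' Set.Ioi 0 = Set.Ioo 0 x := by
    ext t
    simp only [Set.mem_image, Set.mem_Ioi, Set.mem_Ioo]
    constructor
    · rintro ⟨y, hy, rfl⟩
      refine ⟨by positivity, ?_⟩
      rw [div_lt_iff₀ (by positivity)]
      nlinarith [mul_pos hx hx]
    · rintro ⟨h0, h1⟩
      have h2 : 0 < x - t := by linarith
      refine ⟨x * t / (x - t), by positivity, ?_⟩
      have : x + x * t / (x - t) = x ^ 2 / (x - t) := by field_simp; ring
      rw [this]; field_simp
  have hder : ∀ y ∈ Set.Ioi (0:ℝ), HasDerivWithinAt (fun y : ℝ => x * y / (x + y))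
      (x ^ 2 / (x + y) ^ 2) (Set.Ioi 0) y := by
    intro y hy
    have hy' : (0:ℝ) < y := hy
    have h := ((hasDerivAt_id y).const_mul x).div ((hasDerivAt_id y).const_add x)
      (by simp only [id]; positivity)
    refine (h.congr_deriv ?_).hasDerivWithinAt
    simp only [id]
    congr 1; ring
  have hinj : Set.InjOn (fun y : ℝ => x * y / (x + y)) (Set.Ioi 0) := by
    intro y hy z hz h
    have hy' : (0:ℝ) < y := hy
    have hz' : (0:ℝ) < z := hz
    simp only at h
    rw [div_eq_div_iff (by positivity) (by positivity)] at h
    have : x ^ 2 * (y - z) = 0 := by linarith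
    have := (mul_eq_zero.1 this).resolve_left (by positivity)
    linarith
  rw [← himg, lintegral_image_eq_lintegral_abs_deriv_mul measurableSet_Ioi hder hinj]
  refine setLIntegral_congr_fun measurableSet_Ioi fun y hy => ?_
  have hy' : (0:ℝ) < y := hy
  have hft := hf0 (x * y / (x + y))
  rw [← ENNReal.ofReal_mul (by positivity), ← ENNReal.ofReal_mul (by positivity),
    abs_of_nonneg (by positivity)]
  congr 1
  have he : Real.exp (-a / x - b / y - c * (x * y / (x + y))) =
      Real.exp (-c * (x * y / (x + y))) * Real.exp (-b / (x * y / (x + y))) *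
        Real.exp (-(a - b) / x) := by
    rw [← Real.exp_add, ← Real.exp_add]
    congr 1
    field_simp
    ring
  rw [he]
  generalize Real.exp (-c * (x * y / (x + y))) = e1
  generalize Real.exp (-b / (x * y / (x + y))) = e2
  generalize Real.exp (-(a - b) / x) = e3
  generalize f (x * y / (x + y)) = F
  generalize x ^ (-(1:ℝ)/2) = p
  field_simp

lemma outer_int (d t : ℝ) (hd : 0 < d) (ht : 0 < t) :
    (∫⁻ x in Set.Ioi t, ENNReal.ofReal (x ^ (-(1:ℝ)/2) * x⁻¹ * Real.exp (-d / x)))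
    = ENNReal.ofReal (d ^ (-(1:ℝ)/2) * Real.sqrt Real.pi) *
       ENNReal.ofReal (erf (Real.sqrt (d / t))) := by
  set s := Real.sqrt (d / t) with hs
  have hs0 : 0 < s := Real.sqrt_pos.2 (by positivity)
  have hs2 : s ^ 2 = d / t := Real.sq_sqrt (by positivity)
  have himg : (fun u : ℝ => d / u ^ 2) '' Set.Ioo 0 s = Set.Ioi t := by
    ext x
    simp only [Set.mem_image, Set.mem_Ioi, Set.mem_Ioo]
    constructor
    · rintro ⟨u, ⟨hu, hus⟩, rfl⟩
      have : u ^ 2 < d / t := hs2 ▸ pow_lt_pow_left₀ hus hu.le (by norm_num)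
      rw [lt_div_iff₀ (by positivity)] at this ⊢
      linarith
    · intro hx
      have hx0 : 0 < x := ht.trans hx
      refine ⟨Real.sqrt (d / x), ⟨Real.sqrt_pos.2 (by positivity), ?_⟩, ?_⟩
      · apply Real.sqrt_lt_sqrt (by positivity)
        gcongr
      · rw [Real.sq_sqrt (by positivity)]; field_simp
  have hder : ∀ u ∈ Set.Ioo 0 s, HasDerivWithinAt (fun u : ℝ => d / u ^ 2)
      (-(2 * d / u ^ 3)) (Set.Ioo 0 s) u := by
    intro u hu
    have hu' : (0:ℝ) < u := hu.1
    have h := (hasDerivAt_const u d).div (hasDerivAt_pow 2 u) (by positivity)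
    refine (h.congr_deriv ?_).hasDerivWithinAt
    field_simp
    ring
  have hinj : Set.InjOn (fun u : ℝ => d / u ^ 2) (Set.Ioo 0 s) := by
    intro y hy z hz h
    have hy' : (0:ℝ) < y := hy.1
    have hz' : (0:ℝ) < z := hz.1
    simp only at h
    rw [div_eq_div_iff (by positivity) (by positivity)] at h
    have h2 := mul_left_cancel₀ hd.ne' h
    exact ((pow_left_inj₀ hz'.le hy'.le (by norm_num)).1 h2).symm
  rw [← himg, lintegral_image_eq_lintegral_abs_deriv_mul measurableSet_Ioo hder hinj]
  have h1 : ∀ u ∈ Set.Ioo 0 s, ENNReal.ofReal |(-(2 * d / u ^ 3))| *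
      ENNReal.ofReal ((d / u ^ 2) ^ (-(1:ℝ)/2) * (d / u ^ 2)⁻¹ * Real.exp (-d / (d / u ^ 2)))
      = ENNReal.ofReal (2 * d ^ (-(1:ℝ)/2)) * ENNReal.ofReal (Real.exp (-u ^ 2)) := by
    intro u hu
    have hu' : (0:ℝ) < u := hu.1
    rw [← ENNReal.ofReal_mul (by positivity), ← ENNReal.ofReal_mul (by positivity), abs_neg,
      abs_of_nonneg (by positivity)]
    congr 1
    have e1 : -d / (d / u ^ 2) = - u ^ 2 := by field_simp
    have e2 : (d / u ^ 2) ^ (-(1:ℝ)/2) = d ^ (-(1:ℝ)/2) * u := by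
      rw [Real.div_rpow hd.le (by positivity), ← Real.rpow_natCast u 2, ← Real.rpow_mul hu'.le]
      norm_num
      rw [Real.rpow_neg_one]; field_simp
    rw [e1, e2]
    generalize d ^ (-(1:ℝ)/2) = p
    field_simp
  rw [setLIntegral_congr_fun measurableSet_Ioo h1, lintegral_const_mul _ (by fun_prop)]
  have hI : (∫⁻ u in Set.Ioo 0 s, ENNReal.ofReal (Real.exp (-u ^ 2))) =
      ENNReal.ofReal (∫ u in (0:ℝ)..s, Real.exp (-u ^ 2)) := by
    rw [intervalIntegral.integral_of_le hs0.le, integral_Ioc_eq_integral_Ioo,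
      ofReal_integral_eq_lintegral_ofReal]
    · exact (Continuous.integrableOn_Icc (by fun_prop)).mono_set Set.Ioo_subset_Icc_self
    · exact Filter.Eventually.of_forall fun u => (Real.exp_pos _).le
  rw [hI, ← ENNReal.ofReal_mul (by positivity), ← ENNReal.ofReal_mul (by positivity)]
  congr 1
  unfold erf
  have : 0 < Real.sqrt Real.pi := Real.sqrt_pos.2 Real.pi_pos
  field_simp

theorem stmt_15 (a b c : ℝ) (hab : a > b) (hb : b > 0) (hc : c > 0) (f : ℝ → ℝ)
    (hf : Measurable f) (hf0 : ∀ t, 0 ≤ f t) :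
    (∫⁻ x in Set.Ioi (0:ℝ), ∫⁻ y in Set.Ioi (0:ℝ),
        ENNReal.ofReal (x ^ (-(1:ℝ)/2) * y⁻¹ * (x + y)⁻¹ *
          f (x * y / (x + y)) *
          Real.exp (-a / x - b / y - c * (x * y / (x + y)))))
    = ENNReal.ofReal ((a - b) ^ (-(1:ℝ)/2) * Real.sqrt Real.pi) *
      ∫⁻ t in Set.Ioi (0:ℝ),
        ENNReal.ofReal (f t * t⁻¹ * Real.exp (-c * t) * Real.exp (-b / t) *
          erf (Real.sqrt ((a - b) / t))) := by
  rw [setLIntegral_congr_fun measurableSet_Ioi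
    (fun x hx => inner_subst a b c x hx f hf0)]
  set A : ℝ → ENNReal := fun t =>
    ENNReal.ofReal (f t * t⁻¹ * Real.exp (-c * t) * Real.exp (-b / t)) with hA
  set B : ℝ → ENNReal := fun x =>
    ENNReal.ofReal (x ^ (-(1:ℝ)/2) * x⁻¹ * Real.exp (-(a - b) / x)) with hB
  have mA : Measurable A := by fun_prop
  have mB : Measurable B := by fun_prop
  have mS : MeasurableSet {p : ℝ × ℝ | p.2 < p.1} := measurableSet_lt measurable_snd measurable_fst
  have s1 : ∀ x ∈ Set.Ioi (0:ℝ), (∫⁻ t in Set.Ioo 0 x, A t * B x) =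
      ∫⁻ t in Set.Ioi 0, {p : ℝ × ℝ | p.2 < p.1}.indicator (fun p => A p.2 * B p.1) (x, t) := by
    intro x hx
    have : ∀ t, {p : ℝ × ℝ | p.2 < p.1}.indicator (fun p => A p.2 * B p.1) (x, t) =
        (Set.Iio x).indicator (fun t => A t * B x) t := by
      intro t; simp [Set.indicator]
    simp_rw [this]
    rw [setLIntegral_indicator measurableSet_Iio, Set.inter_comm, Set.Ioi_inter_Iio]
  have s2 : ∀ t ∈ Set.Ioi (0:ℝ),
      (∫⁻ x in Set.Ioi 0, {p : ℝ × ℝ | p.2 < p.1}.indicator (fun p => A p.2 * B p.1) (x, t)) =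
      ENNReal.ofReal ((a - b) ^ (-(1:ℝ)/2) * Real.sqrt Real.pi) *
        ENNReal.ofReal (f t * t⁻¹ * Real.exp (-c * t) * Real.exp (-b / t) *
          erf (Real.sqrt ((a - b) / t))) := by
    intro t ht
    have ht' : (0:ℝ) < t := ht
    have : ∀ x, {p : ℝ × ℝ | p.2 < p.1}.indicator (fun p => A p.2 * B p.1) (x, t) =
        (Set.Ioi t).indicator (fun x => A t * B x) x := by
      intro x; simp [Set.indicator]
    simp_rw [this]
    rw [setLIntegral_indicator measurableSet_Ioi, Set.inter_eq_left.2 (Set.Ioi_subset_Ioi ht'.le),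
      lintegral_const_mul _ mB, hB, outer_int (a - b) t (by linarith) ht']
    have := hf0 t
    rw [ENNReal.ofReal_mul (p := f t * t⁻¹ * Real.exp (-c * t) * Real.exp (-b / t))
      (by positivity)]
    ring
  rw [setLIntegral_congr_fun measurableSet_Ioi s1, lintegral_lintegral_swap,
    setLIntegral_congr_fun measurableSet_Ioi s2, lintegral_const_mul' _ _ ENNReal.ofReal_ne_top]
  exact (Measurable.indicator (by fun_prop) mS).aemeasurable
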